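/- Erdős–Gallai theorem: a sequence of nonnegative integers $d_1 \ge d_2 \ge \dots \ge d_n$ is the degree sequence of a simple graph on $n$ vertices if and only if $\sum_{i=1}^n d_i$ is even and for every $1 \le k \le n$, $\sum_{i=1}^k d_i \le k(k-1) + \sum_{i=k+1}^n \min(d_i, k)$. -/

import Mathlib

/-- Degree of vertex `i` in a simple graph on a finite vertex type. -/
noncomputable def degc {n : ℕ} (g : SimpleGraph (Fin n)) (i : Fin n) : ℕ :=
  {j | g.Adj i j}.ncard

namespace EG

structure Good {n : ℕ} (a : Fin n → Fin n → ℤ) : Prop where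
  symm : ∀ i j, a i j = a j i
  diag : ∀ i, a i i = 0
  zo : ∀ i j, a i j = 0 ∨ a i j = 1

def D {n : ℕ} (a : Fin n → Fin n → ℤ) (i : Fin n) : ℤ := ∑ j, a i j

def chi {n : ℕ} (u i : Fin n) : ℤ := if i = u then 1 else 0

def E {n : ℕ} (u v x y : Fin n) : ℤ := chi u x * chi v y + chi v x * chi u y

lemma sum_chi {n : ℕ} (u : Fin n) : ∑ i, chi u i = 1 := by simp [chi]

lemma sum_E {n : ℕ} (u v x : Fin n) : ∑ y, E u v x y = chi u x + chi v x := by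
  simp only [E, Finset.sum_add_distrib, ← Finset.mul_sum, sum_chi, mul_one]

lemma add_edge {n : ℕ} {a : Fin n → Fin n → ℤ} (ha : Good a) {u v : Fin n} (huv : u ≠ v)
    (h : a u v = 0) : ∃ b, Good b ∧ (∀ i, D b i = D a i + chi u i + chi v i) ∧
      ∀ x y, b x y = if (x = u ∧ y = v) ∨ (x = v ∧ y = u) then 1 else a x y := by
  have key : ∀ x y, a x y + E u v x y =
      if (x = u ∧ y = v) ∨ (x = v ∧ y = u) then 1 else a x y := by
    intro x y
    have := ha.symm u v
    simp only [E, chi]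
    grind
  refine ⟨fun x y => a x y + E u v x y, ⟨?_, ?_, ?_⟩, ?_, key⟩
  · intro i j
    have := ha.symm i j
    simp only [key]; grind
  · intro i
    have := ha.diag i
    simp only [key]; grind
  · intro i j
    have := ha.zo i j
    simp only [key]; grind
  · intro i
    simp only [D, Finset.sum_add_distrib, sum_E]; ring

lemma del_edge {n : ℕ} {a : Fin n → Fin n → ℤ} (ha : Good a) {u v : Fin n}
    (h : a u v = 1) : ∃ b, Good b ∧ (∀ i, D b i = D a i - chi u i - chi v i) ∧
      ∀ x y, b x y = if (x = u ∧ y = v) ∨ (x = v ∧ y = u) then 0 else a x y := by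
  have huv : u ≠ v := by
    rintro rfl
    have := ha.diag u
    omega
  have key : ∀ x y, a x y - E u v x y =
      if (x = u ∧ y = v) ∨ (x = v ∧ y = u) then 0 else a x y := by
    intro x y
    have := ha.symm u v
    simp only [E, chi]
    grind
  refine ⟨fun x y => a x y - E u v x y, ⟨?_, ?_, ?_⟩, ?_, key⟩
  · intro i j
    have := ha.symm i j
    simp only [key]; grind
  · intro i
    have := ha.diag i
    simp only [key]; grind
  · intro i j
    have := ha.zo i j
    simp only [key]; grind
  · intro i
    simp only [D, Finset.sum_sub_distrib, sum_E]; ring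

lemma exists_u {n : ℕ} {a : Fin n → Fin n → ℤ} (ha : Good a) {i r : Fin n}
    (h : D a r < D a i) : ∃ u, u ≠ r ∧ a i u = 1 ∧ a r u = 0 := by
  by_contra! hc
  have h1 : D a i = ∑ u, a i (Equiv.swap i r u) :=
    (Equiv.sum_comp (Equiv.swap i r) (fun u => a i u)).symm
  have h2 : D a i ≤ D a r := by
    rw [h1]
    apply Finset.sum_le_sum
    intro u _
    by_cases hi : u = i
    · subst hi; simp [ha.symm u r]
    by_cases hr : u = r
    · subst hr; simp [ha.diag]
    rw [Equiv.swap_apply_of_ne_of_ne hi hr]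
    have := hc u hr
    rcases ha.zo i u with h0 | h0 <;> rcases ha.zo r u with h3 | h3 <;> simp_all
  omega

lemma even_sum {n : ℕ} {a : Fin n → Fin n → ℤ} (ha : Good a) : Even (∑ i, D a i) := by
  rw [← ZMod.intCast_eq_zero_iff_even]
  simp only [D, Int.cast_sum]
  rw [← Finset.sum_product']
  apply Finset.sum_involution (fun p _ => (p.2, p.1))
  · intro p _
    simp only
    rw [ha.symm p.2 p.1]
    exact CharTwo.add_self_eq_zero _
  · rintro ⟨x, y⟩ _ hp heq
    simp only [Prod.mk.injEq] at heq
    apply hp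
    simp [heq.1, ha.diag]
  · intro p _; simp
  · intro p _; simp

lemma card_lt {n k : ℕ} (hk : k ≤ n) :
    (Finset.univ.filter (fun i : Fin n => (i : ℕ) < k)).card = k := by
  have h : (Finset.univ.filter (fun i : Fin n => (i : ℕ) < k)) =
      (Finset.univ : Finset (Fin k)).map (Fin.castLEEmb hk) := by
    ext i
    simp only [Finset.mem_filter, Finset.mem_univ, true_and, Finset.mem_map, Fin.castLEEmb_apply]
    constructor
    · intro hi
      exact ⟨⟨i, hi⟩, rfl⟩
    · rintro ⟨j, rfl⟩
      exact j.2
  rw [h, Finset.card_map, Finset.card_univ, Fintype.card_fin]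

lemma split_sum {n : ℕ} (k : ℕ) (f : Fin n → ℤ) :
    ∑ i, f i = ∑ i ∈ Finset.univ.filter (fun i : Fin n => (i : ℕ) < k), f i +
      ∑ i ∈ Finset.univ.filter (fun i : Fin n => k ≤ (i : ℕ)), f i := by
  rw [← Finset.sum_filter_add_sum_filter_not Finset.univ (fun i : Fin n => (i : ℕ) < k)]
  simp only [not_lt]

lemma block {n k : ℕ} {a : Fin n → Fin n → ℤ} (ha : Good a) :
    ∑ i ∈ Finset.univ.filter (fun i : Fin n => (i : ℕ) < k), D a i =
    ∑ i ∈ Finset.univ.filter (fun i : Fin n => (i : ℕ) < k),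
      ∑ j ∈ Finset.univ.filter (fun i : Fin n => (i : ℕ) < k), a i j +
    ∑ j ∈ Finset.univ.filter (fun i : Fin n => k ≤ (i : ℕ)),
      ∑ i ∈ Finset.univ.filter (fun i : Fin n => (i : ℕ) < k), a j i := by
  have h : ∀ i, D a i = ∑ j ∈ Finset.univ.filter (fun i : Fin n => (i : ℕ) < k), a i j +
      ∑ j ∈ Finset.univ.filter (fun i : Fin n => k ≤ (i : ℕ)), a i j :=
    fun i => split_sum k (a i)
  rw [Finset.sum_congr rfl fun i _ => h i, Finset.sum_add_distrib]
  congr 1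
  rw [Finset.sum_comm]
  exact Finset.sum_congr rfl fun i _ => Finset.sum_congr rfl fun j _ => ha.symm _ _

lemma clique_sum {n k : ℕ} (hk : k ≤ n) :
    ∑ i ∈ Finset.univ.filter (fun i : Fin n => (i : ℕ) < k),
      ∑ j ∈ Finset.univ.filter (fun i : Fin n => (i : ℕ) < k),
        (1 - if i = j then (1 : ℤ) else 0) = k * (k - 1) := by
  have : ∀ i ∈ Finset.univ.filter (fun i : Fin n => (i : ℕ) < k),
      ∑ j ∈ Finset.univ.filter (fun i : Fin n => (i : ℕ) < k),
        (1 - if i = j then (1 : ℤ) else 0) = k - 1 := by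
    intro i hi
    rw [Finset.sum_sub_distrib, Finset.sum_ite_eq, if_pos hi, Finset.sum_const, card_lt hk]
    simp
  rw [Finset.sum_congr rfl this, Finset.sum_const, card_lt hk]
  simp

lemma forward {n k : ℕ} (hk : k ≤ n) {a : Fin n → Fin n → ℤ} (ha : Good a) :
    ∑ i ∈ Finset.univ.filter (fun i : Fin n => (i : ℕ) < k), D a i ≤
      k * (k - 1) + ∑ i ∈ Finset.univ.filter (fun i : Fin n => k ≤ (i : ℕ)), min (D a i) k := by
  rw [block ha, ← clique_sum hk]
  apply add_le_add
  · apply Finset.sum_le_sum; intro i _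
    apply Finset.sum_le_sum; intro j _
    have := ha.zo i j
    have := ha.diag i
    grind
  · apply Finset.sum_le_sum; intro i _
    apply le_min
    · apply Finset.sum_le_sum_of_subset_of_nonneg (Finset.filter_subset _ _)
      intro j _ _
      have := ha.zo i j
      omega
    · calc _ ≤ ∑ j ∈ Finset.univ.filter (fun i : Fin n => (i : ℕ) < k), (1 : ℤ) := by
            apply Finset.sum_le_sum; intro j _
            have := ha.zo i j
            omega
        _ = k := by rw [Finset.sum_const, card_lt hk]; simp

structure Valid {n : ℕ} (d : Fin n → ℤ) (r : Fin n) (a : Fin n → Fin n → ℤ) : Prop where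
  good : Good a
  eq : ∀ i, i < r → D a i = d i
  le : ∀ i, D a i ≤ d i
  ind : ∀ i j, r < i → r < j → a i j = 0

lemma step {n : ℕ} (d : Fin n → ℤ) (hd : Antitone d) (hev : Even (∑ i, d i))
    (hEG : ∀ k : ℕ, 1 ≤ k → k ≤ n →
      ∑ i ∈ Finset.univ.filter (fun i : Fin n => (i : ℕ) < k), d i ≤
      k * (k - 1) + ∑ i ∈ Finset.univ.filter (fun i : Fin n => k ≤ (i : ℕ)), min (d i) k)
    (r : Fin n) (a : Fin n → Fin n → ℤ) (ha : Valid d r a) (hlt : D a r < d r) :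
    ∃ b, Valid d r b ∧ D a r < D b r := by
  by_contra! hmax
  have hg := ha.good
  have hbig : ∀ i, i < r → D a r < D a i := by
    intro i hi
    have := ha.eq i hi
    have := hd hi.le
    omega
  have c0 : ∀ k, r < k → D a k < d k → a r k = 1 := by
    intro k hk hdk
    rcases hg.zo r k with h0 | h0
    swap
    · exact h0
    exfalso
    obtain ⟨b, hb, hD, hv⟩ := add_edge hg hk.ne h0
    have hgt : D a r < D b r := by
      rw [hD]; simp only [chi]; grind
    refine absurd (hmax b ⟨hb, ?_, ?_, ?_⟩) (not_le.mpr hgt)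
    · intro i hi
      have := ha.eq i hi
      rw [hD]; simp only [chi]; grind
    · intro i
      have := ha.le i
      rw [hD]; simp only [chi]; grind
    · intro i j hi hj
      have := ha.ind i j hi hj
      rw [hv]; grind
  have c1 : ∀ i, i < r → a r i = 1 := by
    intro i hi
    rcases hg.zo r i with h0 | h0
    swap
    · exact h0
    exfalso
    obtain ⟨u, hur, hiu, hru⟩ := exists_u hg (hbig i hi)
    have hui : u ≠ i := by
      rintro rfl
      have := hg.diag u
      omega
    have hsu := hg.symm i u
    have hsr := hg.symm r u
    have hsi := hg.symm r i
    obtain ⟨b1, hb1, hD1, hv1⟩ := del_edge hg hiu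
    obtain ⟨b2, hb2, hD2, hv2⟩ := add_edge hb1 hur (by rw [hv1]; grind)
    obtain ⟨b3, hb3, hD3, hv3⟩ := add_edge hb2 hi.ne (by rw [hv2, hv1]; grind)
    have hD3' : ∀ x, D b3 x = D a x + 2 * chi r x := by
      intro x; rw [hD3, hD2, hD1]; ring
    have hv3' : ∀ x y, r < x → r < y → b3 x y = 0 := by
      intro x y hx hy
      have := ha.ind x y hx hy
      rw [hv3, hv2, hv1]; grind
    by_cases h2 : D a r + 2 ≤ d r
    · have hgt : D a r < D b3 r := by
        rw [hD3']; simp [chi]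
      refine absurd (hmax b3 ⟨hb3, ?_, ?_, hv3'⟩) (not_le.mpr hgt)
      · intro x hx
        have := ha.eq x hx
        rw [hD3']; simp only [chi]; grind
      · intro x
        have := ha.le x
        rw [hD3']; simp only [chi]; grind
    · have hk : ∃ k, r < k ∧ D a k < d k := by
        by_contra! hc
        have hx : ∀ x, d x = D a x + chi r x := by
          intro x
          have h3 := ha.le x
          rcases lt_trichotomy x r with h | h | h
          · have := ha.eq x h
            simp only [chi]; grind
          · subst h; simp only [chi]; grind
          · have := hc x h
            simp only [chi]; grind
        simp only [hx, Finset.sum_add_distrib, sum_chi] at hev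
        have := even_sum hg
        grind
      obtain ⟨k, hrk, hdk⟩ := hk
      have hak := c0 k hrk hdk
      obtain ⟨b4, hb4, hD4, hv4⟩ := del_edge (u := r) (v := k) hb3 (by
        rw [hv3, hv2, hv1]; grind)
      have hgt : D a r < D b4 r := by
        rw [hD4, hD3']; simp only [chi]; grind
      refine absurd (hmax b4 ⟨hb4, ?_, ?_, ?_⟩) (not_le.mpr hgt)
      · intro x hx
        have := ha.eq x hx
        rw [hD4, hD3']; simp only [chi]; grind
      · intro x
        have := ha.le x
        rw [hD4, hD3']; simp only [chi]; grind
      · intro x y hx hy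
        have := hv3' x y hx hy
        rw [hv4]; grind
  have hS : ∀ u, u ≠ r → a r u = 0 → r < u := by
    intro u h1 h2
    rcases lt_trichotomy u r with h | h | h
    · have := c1 u h
      omega
    · exact absurd h h1
    · exact h
  have hDk : ∀ k, r < k → D a k =
      ∑ i ∈ Finset.univ.filter (fun i : Fin n => (i : ℕ) < r + 1), a k i := by
    intro k hk
    rw [D, split_sum (r + 1)]
    rw [add_eq_left]
    apply Finset.sum_eq_zero
    intro i hi
    simp only [Finset.mem_filter, Finset.mem_univ, true_and] at hi
    exact ha.ind k i hk (by rw [Fin.lt_def]; omega)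
  have hrn : (r : ℕ) + 1 ≤ n := r.2
  have hDle : ∀ k, r < k → D a k ≤ (r : ℕ) + 1 := by
    intro k hk
    rw [hDk k hk]
    calc _ ≤ ∑ j ∈ Finset.univ.filter (fun i : Fin n => (i : ℕ) < r + 1), (1 : ℤ) := by
          apply Finset.sum_le_sum; intro j _
          have := hg.zo k j
          omega
      _ = _ := by rw [Finset.sum_const, card_lt hrn]; simp
  have c2 : ∀ k, r < k → D a k = min (d k) ((r : ℕ) + 1) := by
    intro k hk
    by_contra hne
    have h1 := ha.le k
    have h2 := hDle k hk
    have h3 : D a k < d k := by grind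
    have h4 : D a k < (r : ℕ) + 1 := by grind
    have hrk := c0 k hk h3
    have : ∃ i, i < r ∧ a k i = 0 := by
      by_contra! hc
      have : D a k = (r : ℕ) + 1 := by
        rw [hDk k hk]
        calc _ = ∑ j ∈ Finset.univ.filter (fun i : Fin n => (i : ℕ) < r + 1), (1 : ℤ) := by
              apply Finset.sum_congr rfl
              intro j hj
              simp only [Finset.mem_filter, Finset.mem_univ, true_and] at hj
              rcases lt_trichotomy j r with h | h | h
              · have := hc j h
                have := hg.zo k j
                omega
              · rw [h, hg.symm]; exact hrk
              · rw [Fin.lt_def] at h; omega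
          _ = _ := by rw [Finset.sum_const, card_lt hrn]; simp
      omega
    obtain ⟨i, hi, hki⟩ := this
    obtain ⟨u, hur, hiu, hru⟩ := exists_u hg (hbig i hi)
    have hsu := hg.symm i u
    have hsr := hg.symm r u
    have hsi := hg.symm r i
    have hsk := hg.symm k i
    have hsk2 := hg.symm k r
    have hui : u ≠ i := by
      rintro rfl
      have := hg.diag u
      omega
    have huk : u ≠ k := by
      rintro rfl
      omega
    obtain ⟨b1, hb1, hD1, hv1⟩ := del_edge hg hiu
    obtain ⟨b2, hb2, hD2, hv2⟩ := add_edge hb1 hur (by rw [hv1]; grind)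
    obtain ⟨b3, hb3, hD3, hv3⟩ := add_edge (u := i) (v := k) hb2 (hi.trans hk).ne
      (by rw [hv2, hv1]; grind)
    have hD3' : ∀ x, D b3 x = D a x + chi r x + chi k x := by
      intro x; rw [hD3, hD2, hD1]; ring
    have hgt : D a r < D b3 r := by
      rw [hD3']; simp only [chi]; grind
    refine absurd (hmax b3 ⟨hb3, ?_, ?_, ?_⟩) (not_le.mpr hgt)
    · intro x hx
      have := ha.eq x hx
      rw [hD3']; simp only [chi]; grind
    · intro x
      have := ha.le x
      rw [hD3']; simp only [chi]; grind
    · intro x y hx hy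
      have := ha.ind x y hx hy
      simp [hv3, hv2, hv1, hx.ne', hy.ne', (hi.trans hx).ne', (hi.trans hy).ne', this]
  have c3 : ∀ i j, i < r → j < r → i ≠ j → a i j = 1 := by
    intro i j hi hj hij
    rcases hg.zo i j with h0 | h0
    swap
    · exact h0
    exfalso
    obtain ⟨u, hur, hiu, hru⟩ := exists_u hg (hbig i hi)
    obtain ⟨w, hwr, hjw, hrw⟩ := exists_u hg (hbig j hj)
    have hu := hS u hur hru
    have hw := hS w hwr hrw
    have hsr := hg.symm r u
    have hsi := hg.symm r i
    have hsj := hg.symm r j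
    have hsij := hg.symm i j
    obtain ⟨b1, hb1, hD1, hv1⟩ := del_edge hg hiu
    obtain ⟨b2, hb2, hD2, hv2⟩ := del_edge (u := j) (v := w) hb1 (by rw [hv1]; grind)
    obtain ⟨b3, hb3, hD3, hv3⟩ := add_edge hb2 hij (by rw [hv2, hv1]; grind)
    obtain ⟨b4, hb4, hD4, hv4⟩ := add_edge hb3 hur (by rw [hv3, hv2, hv1]; grind)
    have hD4' : ∀ x, D b4 x = D a x + chi r x - chi w x := by
      intro x; rw [hD4, hD3, hD2, hD1]; ring
    have hgt : D a r < D b4 r := by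
      rw [hD4']; simp only [chi]; grind
    refine absurd (hmax b4 ⟨hb4, ?_, ?_, ?_⟩) (not_le.mpr hgt)
    · intro x hx
      have := ha.eq x hx
      rw [hD4']; simp only [chi]; grind
    · intro x
      have := ha.le x
      rw [hD4']; simp only [chi]; grind
    · intro x y hx hy
      have := ha.ind x y hx hy
      simp [hv4, hv3, hv2, hv1, hx.ne', hy.ne', (hi.trans hx).ne', (hi.trans hy).ne',
        (hj.trans hx).ne', (hj.trans hy).ne', this]
  have h1 := hEG (r + 1) (by omega) hrn
  have h2 := block (k := r + 1) hg
  have h3 : ∑ i ∈ Finset.univ.filter (fun i : Fin n => (i : ℕ) < r + 1), D a i <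
      ∑ i ∈ Finset.univ.filter (fun i : Fin n => (i : ℕ) < r + 1), d i := by
    apply Finset.sum_lt_sum
    · intro i _; exact ha.le i
    · exact ⟨r, by simp, hlt⟩
  rw [h2] at h3
  refine absurd (h3.trans_le h1) (not_lt.mpr ?_)
  rw [← clique_sum hrn]
  apply add_le_add
  · apply le_of_eq
    apply Finset.sum_congr rfl; intro i hi
    apply Finset.sum_congr rfl; intro j hj
    simp only [Finset.mem_filter, Finset.mem_univ, true_and] at hi hj
    have e1 := hg.symm i j
    have e2 := hg.diag i
    have e3 := c1 i
    have e4 := c1 j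
    have e5 := c3 i j
    have : i < r ∨ i = r := by rw [Fin.lt_def, Fin.ext_iff]; omega
    have : j < r ∨ j = r := by rw [Fin.lt_def, Fin.ext_iff]; omega
    grind
  · apply le_of_eq
    apply Finset.sum_congr rfl; intro i hi
    simp only [Finset.mem_filter, Finset.mem_univ, true_and] at hi
    have hri : r < i := by rw [Fin.lt_def]; omega
    rw [← hDk i hri, c2 i hri]
    push_cast; rfl

lemma backward {n : ℕ} (d : Fin n → ℤ) (hd0 : ∀ i, 0 ≤ d i) (hd : Antitone d)
    (hev : Even (∑ i, d i))
    (hEG : ∀ k : ℕ, 1 ≤ k → k ≤ n →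
      ∑ i ∈ Finset.univ.filter (fun i : Fin n => (i : ℕ) < k), d i ≤
      k * (k - 1) + ∑ i ∈ Finset.univ.filter (fun i : Fin n => k ≤ (i : ℕ)), min (d i) k) :
    ∃ a, Good a ∧ ∀ i, D a i = d i := by
  have main : ∀ m : ℕ, m ≤ n → ∃ a, Good a ∧ (∀ i : Fin n, (i : ℕ) < m → D a i = d i) ∧
      (∀ i, D a i ≤ d i) ∧ ∀ i j : Fin n, m ≤ (i : ℕ) → m ≤ (j : ℕ) → a i j = 0 := by
    intro m
    induction m with
    | zero =>
      intro _
      refine ⟨fun _ _ => 0, ⟨by simp, by simp, by simp⟩, by simp, ?_, by simp⟩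
      intro i; simpa [D] using hd0 i
    | succ m ih =>
      intro hm
      obtain ⟨a, ha, h1, h2, h3⟩ := ih (by omega)
      let r : Fin n := ⟨m, hm⟩
      have hva : Valid d r a := ⟨ha, fun i hi => h1 i hi, h2,
        fun i j hi hj => h3 i j (le_of_lt hi) (le_of_lt hj)⟩
      have key : ∀ t : ℕ, ∃ b, Valid d r b ∧ (D b r = d r ∨ D a r + t ≤ D b r) := by
        intro t
        induction t with
        | zero => exact ⟨a, hva, Or.inr (by simp)⟩
        | succ t iht =>
          obtain ⟨b, hb, h⟩ := iht
          by_cases he : D b r = d r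
          · exact ⟨b, hb, Or.inl he⟩
          · obtain ⟨c, hc, hbc⟩ := step d hd hev hEG r b hb (lt_of_le_of_ne (hb.le r) he)
            refine ⟨c, hc, Or.inr ?_⟩
            push_cast
            rcases h with h | h
            · exact absurd h he
            · omega
      obtain ⟨b, hb, h⟩ := key (d r - D a r).toNat
      have hbr : D b r = d r := by
        have := hb.le r
        rcases h with h | h <;> omega
      refine ⟨b, hb.good, ?_, hb.le, ?_⟩
      · intro i hi
        by_cases hir : i = r
        · rw [hir, hbr]
        · apply hb.eq
          have : (i : ℕ) ≠ m := fun h => hir (Fin.ext h)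
          rw [Fin.lt_def]; change (i : ℕ) < m; omega
      · intro i j hi hj
        exact hb.ind i j hi hj
  obtain ⟨a, ha, h1, _⟩ := main n le_rfl
  exact ⟨a, ha, fun i => h1 i i.2⟩

lemma degc_eq {n : ℕ} (g : SimpleGraph (Fin n)) (a : Fin n → Fin n → ℤ)
    (h1 : ∀ i j, g.Adj i j → a i j = 1) (h0 : ∀ i j, ¬ g.Adj i j → a i j = 0) (i : Fin n) :
    (degc g i : ℤ) = D a i := by
  classical
  have : ∀ j, a i j = if g.Adj i j then 1 else 0 := by
    intro j
    split_ifs with h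
    · exact h1 i j h
    · exact h0 i j h
  simp only [D, this, degc]
  rw [Finset.sum_boole, Set.ncard_eq_toFinset_card']
  simp

end EG

theorem stmt_8 {n : ℕ} (d : Fin n → ℕ) (hmono : Antitone d) :
    (∃ g : SimpleGraph (Fin n), ∀ i, degc g i = d i) ↔
      (Even (∑ i, d i) ∧
        ∀ k : ℕ, 1 ≤ k → k ≤ n →
          ∑ i ∈ Finset.univ.filter (fun i : Fin n => (i : ℕ) < k), d i ≤
            k * (k - 1) +
              ∑ i ∈ Finset.univ.filter (fun i : Fin n => k ≤ (i : ℕ)),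
                min (d i) k) := by

  classical
  have hcast : ∀ k : ℕ, 1 ≤ k → ((∑ i ∈ Finset.univ.filter (fun i : Fin n => (i : ℕ) < k), d i ≤
            k * (k - 1) +
              ∑ i ∈ Finset.univ.filter (fun i : Fin n => k ≤ (i : ℕ)),
                min (d i) k) ↔
      (∑ i ∈ Finset.univ.filter (fun i : Fin n => (i : ℕ) < k), (d i : ℤ) ≤
      k * (k - 1) +
        ∑ i ∈ Finset.univ.filter (fun i : Fin n => k ≤ (i : ℕ)), min (d i : ℤ) k)) := by
    intro k hk
    zify [hk]
  have hevc : Even (∑ i, d i) ↔ Even (∑ i, (d i : ℤ)) := by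
    rw [← Int.even_coe_nat]; push_cast; rfl
  rw [hevc]
  constructor
  · rintro ⟨g, hg⟩
    let a : Fin n → Fin n → ℤ := fun i j => if g.Adj i j then 1 else 0
    have ha : EG.Good a := by
      refine ⟨?_, ?_, ?_⟩
      · intro i j; simp [a, g.adj_comm]
      · intro i; simp [a]
      · intro i j; simp only [a]; split_ifs <;> simp
    have hD : ∀ i, (d i : ℤ) = EG.D a i := by
      intro i
      rw [← hg i]
      exact EG.degc_eq g a (by intro i j h; simp [a, h]) (by intro i j h; simp [a, h]) i
    constructor
    · simp only [hD]; exact EG.even_sum ha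
    · intro k hk hkn
      rw [hcast k hk]
      simp only [hD]
      exact EG.forward hkn ha
  · rintro ⟨hev, h⟩
    obtain ⟨a, ha, hD⟩ := EG.backward (fun i => (d i : ℤ)) (by simp)
      (fun i j hij => by simpa using hmono hij) hev
      (fun k hk hkn => (hcast k hk).1 (h k hk hkn))
    refine ⟨⟨fun i j => a i j = 1, ?_, ?_⟩, ?_⟩
    · refine ⟨fun i j hij => ?_⟩
      rw [ha.symm]; exact hij
    · refine ⟨fun i hi => ?_⟩
      have := ha.diag i
      omega
    · intro i
      have := EG.degc_eq (n := n) ⟨fun i j => a i j = 1, by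
        refine ⟨fun i j hij => ?_⟩
        rw [ha.symm]; exact hij, by
        refine ⟨fun i hi => ?_⟩
        have := ha.diag i
        omega⟩ a (fun i j h => h) (fun i j h => (ha.zo i j).resolve_right h) i
      rw [hD] at this
      exact_mod_cast this
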